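/- Let φ and ψ be free BDTs and let l be a leaf of φ and m a leaf of ψ that are compatible. Then there exists a valuation v of the variables such that evaluating φ under v reaches the leaf l and evaluating ψ under v reaches the leaf m; consequently, if l and m carry different labels, then φ and ψ are not equivalent. -/

import Mathlib

/-- Binary decision trees: leaves labeled `0`/`1` (as `Bool`), inner vertices labeled
by Boolean variables; `node x l r` has left subtree `l` and right subtree `r`. -/
inductive BDT : Type
  | leaf : Bool → BDT
  | node : ℕ → BDT → BDT → BDT
deriving DecidableEq

namespace BDT

/-- Evaluation of a BDT under a valuation: go left when the variable is `false` (0),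
right when it is `true` (1), and return the label of the leaf reached. -/
def eval (v : ℕ → Bool) : BDT → Bool
  | leaf b => b
  | node x l r => if v x then r.eval v else l.eval v

/-- Two BDTs are equivalent when they compute the same Boolean function. -/
def Equiv (φ ψ : BDT) : Prop := ∀ v : ℕ → Bool, φ.eval v = ψ.eval v

/-- Variables occurring in a BDT. -/
def vars : BDT → Finset ℕ
  | leaf _ => ∅
  | node x l r => insert x (l.vars ∪ r.vars)

/-- A BDT is free when no variable occurs twice on a path from the root to a leaf. -/
def Free : BDT → Prop
  | leaf _ => True
  | node x l r => x ∉ l.vars ∧ x ∉ r.vars ∧ l.Free ∧ r.Free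

/-- A leaf of a BDT is identified by the path from the root reaching it
(`false` = left branch, `true` = right branch); `leafAt` returns its label. -/
def leafAt : BDT → List Bool → Option Bool
  | leaf b, [] => some b
  | node _ l r, d :: p => if d then r.leafAt p else l.leafAt p
  | _, _ => none

/-- The branch data of a path: the list of variables encountered from the root,
together with the direction (left = `false` / right = `true`) through which the path
leaves each of them. -/
def branch : BDT → List Bool → List (ℕ × Bool)
  | node x l r, d :: p => (x, d) :: (if d then r.branch p else l.branch p)
  | _, _ => []

/-- The path followed when evaluating a BDT under a valuation `v`. -/
def evalPath (v : ℕ → Bool) : BDT → List Bool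
  | leaf _ => []
  | node x l r => v x :: (if v x then r.evalPath v else l.evalPath v)

end BDT

/-- Two leaves, given by the path `p` to a leaf of `φ` and the path `q` to a leaf of
`ψ`, are compatible if no variable appears on both paths while being left through
opposite (left/right) branches. -/
def Compatible (φ : BDT) (p : List Bool) (ψ : BDT) (q : List Bool) : Prop :=
  ∀ (x : ℕ) (d d' : Bool), (x, d) ∈ φ.branch p → (x, d') ∈ ψ.branch q → d = d'

namespace BDT

theorem mem_vars_of_mem_branch {φ : BDT} {p : List Bool} {x : ℕ} {d : Bool}
    (h : (x, d) ∈ φ.branch p) : x ∈ φ.vars := by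
  induction φ generalizing p with
  | leaf b => simp [branch] at h
  | node y l r ihl ihr =>
    cases p with
    | nil => simp [branch] at h
    | cons e p => cases e <;> simp [branch, vars] at h ⊢ <;> grind

/-- In a free BDT, a path leaves each variable in only one direction, so it is compatible
with itself. -/
theorem Free.compatible_self {φ : BDT} (hφ : φ.Free) (p : List Bool) :
    Compatible φ p φ p := by
  induction φ generalizing p with
  | leaf b => intro x d d' h; simp [branch] at h
  | node y l r ihl ihr =>
    obtain ⟨hl, hr, hfl, hfr⟩ := hφ
    intro x d d' h h'
    cases p with
    | nil => simp [branch] at h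
    | cons e p =>
      have hlp := ihl hfl p x d d'
      have hrp := ihr hfr p x d d'
      have hlv := fun c => @mem_vars_of_mem_branch l p x c
      have hrv := fun c => @mem_vars_of_mem_branch r p x c
      cases e <;> simp [branch] at h h' <;> grind

theorem evalPath_eq_of_forall_mem_branch {φ : BDT} {p : List Bool} {b : Bool} {v : ℕ → Bool}
    (hp : φ.leafAt p = some b) (hv : ∀ x d, (x, d) ∈ φ.branch p → v x = d) :
    φ.evalPath v = p := by
  induction φ generalizing p with
  | leaf c => cases p <;> simp_all [leafAt, evalPath]
  | node y l r ihl ihr =>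
    cases p with
    | nil => simp [leafAt] at hp
    | cons e p =>
      have hy : v y = e := hv y e (by simp [branch])
      cases e
      · simp only [evalPath, hy]
        exact congrArg _ (ihl hp fun x d h => hv x d (List.mem_cons_of_mem _ h))
      · simp only [evalPath, hy]
        exact congrArg _ (ihr hp fun x d h => hv x d (List.mem_cons_of_mem _ h))

theorem leafAt_evalPath (φ : BDT) (v : ℕ → Bool) :
    φ.leafAt (φ.evalPath v) = some (φ.eval v) := by
  induction φ with
  | leaf b => rfl
  | node y l r ihl ihr => cases h : v y <;> simp [evalPath, leafAt, eval, h, ihl, ihr]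

end BDT

/-- Let `φ`, `ψ` be free BDTs, `p` the path to a leaf of `φ` with label `b`, and `q`
the path to a leaf of `ψ` with label `c`.  If the two leaves are compatible then some
valuation `v` makes the evaluation of `φ` reach the first leaf and the evaluation of
`ψ` reach the second; consequently, if the two leaves carry different labels then `φ`
and `ψ` are not equivalent. -/
theorem compatible_leaves_reachable
    (φ ψ : BDT) (hφ : φ.Free) (hψ : ψ.Free) (p q : List Bool) (b c : Bool)
    (hp : φ.leafAt p = some b) (hq : ψ.leafAt q = some c)
    (hcomp : Compatible φ p ψ q) :
    (∃ v : ℕ → Bool, φ.evalPath v = p ∧ ψ.evalPath v = q) ∧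
      (b ≠ c → ¬ BDT.Equiv φ ψ) := by
  have hv : ∃ v : ℕ → Bool, φ.evalPath v = p ∧ ψ.evalPath v = q := by
    refine ⟨fun x => decide ((x, true) ∈ φ.branch p ∨ (x, true) ∈ ψ.branch q),
      BDT.evalPath_eq_of_forall_mem_branch hp fun x d h => ?_,
      BDT.evalPath_eq_of_forall_mem_branch hq fun x d h => ?_⟩
    · have h₁ := hφ.compatible_self p x d true h
      have h₂ := hcomp x d true h
      cases d <;> simp_all
    · have h₁ := hψ.compatible_self q x d true h
      have h₂ := fun h' => hcomp x true d h' h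
      cases d <;> simp_all
  refine ⟨hv, fun hbc hequiv => hbc ?_⟩
  obtain ⟨v, rfl, rfl⟩ := hv
  rw [BDT.leafAt_evalPath, Option.some_inj] at hp hq
  rw [← hp, ← hq, hequiv v]
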